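/- arXiv:1905.08664 — 4 statements merged into one kernel-verified Lean document; each statement's English description precedes it below -/
import Mathlib

section
/- Let m ∈ ℕ and let p : ℤ^d → ℕ → ℚ be a poly-exponential expression. Then the function (x, n) ↦ ∑_{i=1}^{n} m^{n−i} · p(x, i−1) is again a poly-exponential expression. -/
/-- A function `p : ℤ^d → ℕ → ℚ` is a poly-exponential expression if it is a
finite sum of terms `1_{S_j}(n) · α_j(x) · n^{a_j} · b_j^n` where each `S_j ⊆ ℕ`
is empty, a singleton, or has finite complement, each `α_j` is affine, and
`b_j ≥ 1`. -/
def IsPolyExp {d : ℕ} (p : (Fin d → ℤ) → ℕ → ℚ) : Prop :=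
  ∃ (ℓ : ℕ) (S : Fin ℓ → Set ℕ) (v : Fin ℓ → Fin d → ℚ) (w : Fin ℓ → ℚ)
    (a : Fin ℓ → ℕ) (b : Fin ℓ → ℕ),
    (∀ j, S j = ∅ ∨ (∃ c : ℕ, S j = {c}) ∨ (S j)ᶜ.Finite) ∧
    (∀ j, 1 ≤ b j) ∧
    ∀ (x : Fin d → ℤ) (n : ℕ),
      p x n = ∑ j, (S j).indicator (fun _ => (1 : ℚ)) n *
        ((∑ i, v j i * (x i : ℚ)) + w j) * (n : ℚ) ^ a j * (b j : ℚ) ^ n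

/-- The space of exponential polynomials: the linear span of the sequences `n ^ a * b ^ n`
with `b ≥ 1`. -/
def expPoly : Submodule ℚ (ℕ → ℚ) :=
  Submodule.span ℚ {f | ∃ a b : ℕ, 1 ≤ b ∧ f = fun n : ℕ => (n : ℚ) ^ a * (b : ℚ) ^ n}

lemma pow_mul_pow_mem_expPoly (a : ℕ) {b : ℕ} (hb : 1 ≤ b) :
    (fun n : ℕ => (n : ℚ) ^ a * (b : ℚ) ^ n) ∈ expPoly :=
  Submodule.subset_span ⟨a, b, hb, rfl⟩

/-- The exponential polynomials of the form `H (n + 1) - m * H n` with `H` an exponential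
polynomial. -/
def expPolyDifferences (m : ℕ) : Submodule ℚ (ℕ → ℚ) where
  carrier := {h | ∃ H ∈ expPoly, ∀ n, H (n + 1) = m * H n + h n}
  zero_mem' := ⟨0, expPoly.zero_mem, by simp⟩
  add_mem' := by
    rintro f g ⟨F, hF, hF'⟩ ⟨G, hG, hG'⟩
    refine ⟨F + G, expPoly.add_mem hF hG, fun n => ?_⟩
    simp only [Pi.add_apply, hF', hG']
    ring
  smul_mem' := by
    rintro c f ⟨F, hF, hF'⟩
    refine ⟨c • F, expPoly.smul_mem c hF, fun n => ?_⟩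
    simp only [Pi.smul_apply, smul_eq_mul, hF']
    ring

lemma pow_mul_pow_mem_expPolyDifferences (m : ℕ) {b : ℕ} (hb : 1 ≤ b) (a : ℕ) :
    (fun n : ℕ => (n : ℚ) ^ a * (b : ℚ) ^ n) ∈ expPolyDifferences m := by
  induction a using Nat.strong_induction_on with
  | _ a ih =>
    have hb0 : (b : ℚ) ≠ 0 := by positivity
    have lower (e : ℕ → ℚ) : (∑ k ∈ Finset.range a,
        e k • fun n : ℕ => (n : ℚ) ^ k * (b : ℚ) ^ n) ∈ expPolyDifferences m :=
      Submodule.sum_mem _ fun k hk => Submodule.smul_mem _ _ (ih k (Finset.mem_range.1 hk))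
    -- It suffices to realise a nonzero multiple of the sequence modulo lower powers of `n`.
    have key (r : ℕ) (c : ℚ) (hc : c ≠ 0) (e : ℕ → ℚ)
        (h : ∀ n : ℕ, ((n : ℚ) + 1) ^ r * (b : ℚ) ^ (n + 1) = m * ((n : ℚ) ^ r * (b : ℚ) ^ n) +
          (c * ((n : ℚ) ^ a * (b : ℚ) ^ n) +
            ∑ k ∈ Finset.range a, e k * ((n : ℚ) ^ k * (b : ℚ) ^ n))) :
        (fun n : ℕ => (n : ℚ) ^ a * (b : ℚ) ^ n) ∈ expPolyDifferences m := by
      have hsum : (c • fun n : ℕ => (n : ℚ) ^ a * (b : ℚ) ^ n) +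
          ∑ k ∈ Finset.range a, e k • (fun n : ℕ => (n : ℚ) ^ k * (b : ℚ) ^ n) ∈
            expPolyDifferences m := by
        refine ⟨_, pow_mul_pow_mem_expPoly r hb, fun n => ?_⟩
        simpa [Finset.sum_apply] using h n
      have := (Submodule.add_mem_iff_left _ (lower e)).1 hsum
      exact (Submodule.smul_mem_iff _ hc).1 this
    by_cases hbm : b = m
    · subst hbm
      refine key (a + 1) (b * (a + 1)) (by positivity) (fun k => b * (a + 1).choose k) fun n => ?_
      rw [add_pow, Finset.sum_range_succ, Finset.sum_range_succ]
      simp only [one_pow, mul_one, Nat.choose_self, Nat.choose_succ_self_right, Nat.cast_one,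
        add_mul, Finset.sum_mul]
      rw [Finset.sum_congr rfl fun k _ => show (n : ℚ) ^ k * ((a + 1).choose k : ℚ) * b ^ (n + 1) =
        b * (a + 1).choose k * (n ^ k * b ^ n) by ring]
      push_cast
      ring
    · refine key a (b - m) (sub_ne_zero.2 (by exact_mod_cast hbm)) (fun k => b * a.choose k)
        fun n => ?_
      rw [add_pow, Finset.sum_range_succ]
      simp only [one_pow, mul_one, Nat.choose_self, Nat.cast_one, add_mul, Finset.sum_mul]
      rw [Finset.sum_congr rfl fun k _ => show (n : ℚ) ^ k * (a.choose k : ℚ) * b ^ (n + 1) =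
        b * a.choose k * (n ^ k * b ^ n) by ring]
      ring

lemma expPoly_le_expPolyDifferences (m : ℕ) : expPoly ≤ expPolyDifferences m := by
  refine Submodule.span_le.2 ?_
  rintro _ ⟨a, b, hb, rfl⟩
  exact pow_mul_pow_mem_expPolyDifferences m hb a

/-- A sequence agreeing with an exponential polynomial from some index on. -/
def EventuallyExpPoly (f : ℕ → ℚ) : Prop :=
  ∃ h ∈ expPoly, ∃ N : ℕ, ∀ n, N ≤ n → f n = h n

lemma EventuallyExpPoly.of_recurrence {m : ℕ} {f g : ℕ → ℚ} (hf : EventuallyExpPoly f)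
    (hg : ∀ n, g (n + 1) = m * g n + f n) : EventuallyExpPoly g := by
  obtain ⟨h, hh, N, hN⟩ := hf
  obtain ⟨H, hH, hrec⟩ := expPoly_le_expPolyDifferences m hh
  have hdiff (k : ℕ) : g (N + k) = H (N + k) + m ^ k * (g N - H N) := by
    induction k with
    | zero => simp
    | succ k ih =>
      rw [← add_assoc, hg, hrec, ih, hN _ (Nat.le_add_right N k)]
      ring
  rcases Nat.eq_zero_or_pos m with rfl | hm
  · refine ⟨H, hH, N + 1, fun n hn => ?_⟩
    obtain ⟨k, rfl⟩ := Nat.exists_eq_add_of_le hn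
    simpa [add_assoc, add_comm 1 k] using hdiff (k + 1)
  · have hm0 : (m : ℚ) ≠ 0 := by positivity
    refine ⟨_, expPoly.add_mem hH (expPoly.smul_mem ((g N - H N) / m ^ N)
      (pow_mul_pow_mem_expPoly 0 hm)), N, fun n hn => ?_⟩
    obtain ⟨k, rfl⟩ := Nat.exists_eq_add_of_le hn
    rw [hdiff]
    simp only [Pi.add_apply, Pi.smul_apply, smul_eq_mul, pow_zero, one_mul, pow_add]
    field_simp

lemma eventuallyExpPoly_indicator_mul {S : Set ℕ}
    (hS : S = ∅ ∨ (∃ c : ℕ, S = {c}) ∨ Sᶜ.Finite) (a : ℕ) {b : ℕ} (hb : 1 ≤ b) :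
    EventuallyExpPoly fun n =>
      S.indicator (fun _ => (1 : ℚ)) n * ((n : ℚ) ^ a * (b : ℚ) ^ n) := by
  rcases hS with rfl | ⟨c, rfl⟩ | hS
  · exact ⟨0, expPoly.zero_mem, 0, by simp⟩
  · refine ⟨0, expPoly.zero_mem, c + 1, fun n hn => ?_⟩
    have : n ≠ c := by omega
    simp [this]
  · obtain ⟨N, hN⟩ := hS.bddAbove
    refine ⟨_, pow_mul_pow_mem_expPoly a hb, N + 1, fun n hn => ?_⟩
    have : n ∈ S := by
      by_contra hnS
      have := hN hnS
      omega
    simp [this]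

lemma isPolyExp_term {d : ℕ} {S : Set ℕ} (hS : S = ∅ ∨ (∃ c : ℕ, S = {c}) ∨ Sᶜ.Finite)
    (v : Fin d → ℚ) (w : ℚ) (a : ℕ) {b : ℕ} (hb : 1 ≤ b) :
    IsPolyExp fun (x : Fin d → ℤ) (n : ℕ) => S.indicator (fun _ => (1 : ℚ)) n *
      ((∑ i, v i * (x i : ℚ)) + w) * (n : ℚ) ^ a * (b : ℚ) ^ n :=
  ⟨1, fun _ => S, fun _ => v, fun _ => w, fun _ => a, fun _ => b, fun _ => hS, fun _ => hb,
    by simp⟩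

lemma IsPolyExp.sum {d : ℕ} {ι : Type*} [Fintype ι] {p : ι → (Fin d → ℤ) → ℕ → ℚ}
    (hp : ∀ j, IsPolyExp (p j)) : IsPolyExp fun x n => ∑ j, p j x n := by
  choose ℓ S v w a b hS hb h using hp
  let e := (Fintype.equivFin ((j : ι) × Fin (ℓ j))).symm
  refine ⟨_, fun k => S (e k).1 (e k).2, fun k => v (e k).1 (e k).2, fun k => w (e k).1 (e k).2,
    fun k => a (e k).1 (e k).2, fun k => b (e k).1 (e k).2, fun k => hS _ _, fun k => hb _ _,
    fun x n => ?_⟩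
  simp only [h]
  rw [← Fintype.sum_sigma' fun j k => (S j k).indicator (fun _ => (1 : ℚ)) n *
    ((∑ i, v j k i * (x i : ℚ)) + w j k) * (n : ℚ) ^ a j k * (b j k : ℚ) ^ n]
  exact (Equiv.sum_comp e _).symm

lemma IsPolyExp.add {d : ℕ} {p q : (Fin d → ℤ) → ℕ → ℚ} (hp : IsPolyExp p) (hq : IsPolyExp q) :
    IsPolyExp fun x n => p x n + q x n := by
  have h : ∀ j : Fin 2, IsPolyExp (![p, q] j) := by
    intro j
    fin_cases j
    exacts [hp, hq]
  simpa [Fin.sum_univ_two] using IsPolyExp.sum h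

lemma isPolyExp_affine_mul_of_mem_expPoly {d : ℕ} {f : ℕ → ℚ} (hf : f ∈ expPoly)
    (v : Fin d → ℚ) (w : ℚ) :
    IsPolyExp fun (x : Fin d → ℤ) (n : ℕ) => ((∑ i, v i * (x i : ℚ)) + w) * f n := by
  induction hf using Submodule.span_induction generalizing v w with
  | mem f hf =>
    obtain ⟨a, b, hb, rfl⟩ := hf
    simpa [mul_assoc] using
      isPolyExp_term (S := Set.univ) (Or.inr (Or.inr (by simp))) v w a hb
  | zero =>
    simpa using isPolyExp_term (S := ∅) (Or.inl rfl) v w 0 le_rfl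
  | add f g _ _ hf hg =>
    simpa [mul_add] using (hf v w).add (hg v w)
  | smul c f _ hf =>
    convert hf (fun i => c * v i) (c * w) using 3 with x n
    simp only [mul_assoc, ← Finset.mul_sum, ← mul_add, Pi.smul_apply, smul_eq_mul]
    ring

lemma EventuallyExpPoly.isPolyExp_affine_mul {d : ℕ} {f : ℕ → ℚ} (hf : EventuallyExpPoly f)
    (v : Fin d → ℚ) (w : ℚ) :
    IsPolyExp fun (x : Fin d → ℤ) (n : ℕ) => ((∑ i, v i * (x i : ℚ)) + w) * f n := by
  obtain ⟨h, hh, N, hN⟩ := hf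
  have hfin := IsPolyExp.sum fun c : Fin N =>
    isPolyExp_term (S := {(c : ℕ)}) (Or.inr (Or.inl ⟨_, rfl⟩))
      (fun i => (f c - h c) * v i) ((f c - h c) * w) 0 le_rfl
  convert (isPolyExp_affine_mul_of_mem_expPoly hh v w).add hfin using 3 with x n
  simp only [mul_assoc, ← Finset.mul_sum, ← mul_add, pow_zero, Nat.cast_one, one_pow, mul_one]
  generalize ∑ i, v i * (x i : ℚ) = s
  by_cases hn : n < N
  · rw [Finset.sum_eq_single ⟨n, hn⟩]
    · simp
      ring
    · intro c _ hc
      have : n ≠ c := fun h => hc (Fin.ext h.symm)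
      simp [this]
    · simp
  · rw [Finset.sum_eq_zero, add_zero, hN n (not_lt.1 hn)]
    intro c _
    have : n ≠ c := by omega
    simp [this]

/-- poly-exponential expressions are closed under the sum
`(x, n) ↦ ∑_{i=1}^{n} m^{n−i} · p(x, i−1)`. -/
theorem polyExp_closed_under_sum (d : ℕ) (hd : 1 ≤ d) (m : ℕ)
    (p : (Fin d → ℤ) → ℕ → ℚ) (hp : IsPolyExp p) :
    IsPolyExp (fun (x : Fin d → ℤ) (n : ℕ) =>
      ∑ i ∈ Finset.Icc 1 n, (m : ℚ) ^ (n - i) * p x (i - 1)) := by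
  obtain ⟨ℓ, S, v, w, a, b, hS, hb, h⟩ := hp
  let f (j : Fin ℓ) (n : ℕ) : ℚ :=
    (S j).indicator (fun _ => (1 : ℚ)) n * ((n : ℚ) ^ a j * (b j : ℚ) ^ n)
  let g (j : Fin ℓ) (n : ℕ) : ℚ := ∑ i ∈ Finset.Icc 1 n, (m : ℚ) ^ (n - i) * f j (i - 1)
  have hg (j : Fin ℓ) : EventuallyExpPoly (g j) := by
    refine (eventuallyExpPoly_indicator_mul (hS j) (a j) (hb j)).of_recurrence (m := m)
      fun n => ?_
    change ∑ i ∈ Finset.Icc 1 (n + 1), (m : ℚ) ^ (n + 1 - i) * f j (i - 1) =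
      m * ∑ i ∈ Finset.Icc 1 n, (m : ℚ) ^ (n - i) * f j (i - 1) + f j n
    rw [Finset.sum_Icc_succ_top (by omega), Finset.mul_sum]
    congr 1
    · refine Finset.sum_congr rfl fun i hi => ?_
      rw [Nat.succ_sub (Finset.mem_Icc.1 hi).2, pow_succ]
      ring
    · simp
  convert IsPolyExp.sum fun j => (hg j).isPolyExp_affine_mul (v j) (w j) using 3 with x n
  simp only [g, f, h, Finset.mul_sum]
  rw [Finset.sum_comm]
  refine Finset.sum_congr rfl fun j _ => Finset.sum_congr rfl fun i _ => ?_
  ring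
end

section
/- Let m ∈ ℕ, let p : ℤ^d → ℕ → ℚ be a poly-exponential expression, and fix a coordinate index k ∈ {1,…,d}. Then there exists a poly-exponential expression q : ℤ^d → ℕ → ℚ such that for all x ∈ ℤ^d: q(x, 0) = x_k, and q(x, n) = m · q(x, n−1) + p(x, n−1) for all n > 0. -/
namespace PolyExp

open Finset

/-- The sequence `n ↦ n ^ a * b ^ n`. -/
def powExp (a b : ℕ) : ℕ → ℚ := fun n => (n : ℚ) ^ a * (b : ℚ) ^ n

/-- The linear span of the sequences `n ^ a * b ^ n` with `1 ≤ b` and of the unit sequences. -/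
def seqSpan : Submodule ℚ (ℕ → ℚ) :=
  Submodule.span ℚ ({f | ∃ a b : ℕ, 1 ≤ b ∧ f = powExp a b} ∪ {f | ∃ c : ℕ, f = Pi.single c 1})

/-- The operator sending `g` to `n ↦ g (n + 1) - m * g n`. -/
def recOp (m : ℚ) : (ℕ → ℚ) →ₗ[ℚ] (ℕ → ℚ) where
  toFun g n := g (n + 1) - m * g n
  map_add' f g := by ext n; simp only [Pi.add_apply]; ring
  map_smul' c g := by ext n; simp only [Pi.smul_apply, smul_eq_mul, RingHom.id_apply]; ring

lemma recOp_apply (m : ℚ) (g : ℕ → ℚ) (n : ℕ) : recOp m g n = g (n + 1) - m * g n := rfl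

lemma powExp_mem_seqSpan (a : ℕ) {b : ℕ} (hb : 1 ≤ b) : powExp a b ∈ seqSpan :=
  Submodule.subset_span (Or.inl ⟨a, b, hb, rfl⟩)

lemma single_mem_seqSpan (c : ℕ) : (Pi.single c 1 : ℕ → ℚ) ∈ seqSpan :=
  Submodule.subset_span (Or.inr ⟨c, rfl⟩)

lemma geom_mem_seqSpan (m : ℕ) : (fun n => (m : ℚ) ^ n) ∈ seqSpan := by
  rcases Nat.eq_zero_or_pos m with rfl | hm
  · convert single_mem_seqSpan 0 using 1
    ext n
    cases n <;> simp
  · convert powExp_mem_seqSpan 0 hm using 1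
    ext n
    simp [powExp]

lemma recOp_powExp (m : ℚ) (a b : ℕ) :
    recOp m (powExp a b) =
      ((b : ℚ) - m) • powExp a b + (b : ℚ) • ∑ i ∈ range a, (a.choose i : ℚ) • powExp i b := by
  ext n
  simp only [recOp_apply, powExp, Pi.add_apply, Pi.smul_apply, Finset.sum_apply, smul_eq_mul]
  push_cast
  rw [add_pow, sum_range_succ]
  simp only [one_pow, mul_one, Nat.choose_self, Nat.cast_one, add_mul, mul_sum, sum_mul]
  rw [add_sub_assoc, add_comm]
  congr 1
  · ring
  · exact sum_congr rfl fun i _ => by ring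

lemma powExp_mem_map_recOp (m a : ℕ) {b : ℕ} (hb : 1 ≤ b) :
    powExp a b ∈ seqSpan.map (recOp m) := by
  induction a using Nat.strong_induction_on with
  | _ a ih =>
    have hb0 : (b : ℚ) ≠ 0 := by positivity
    have lower : ∑ i ∈ range a, (a.choose i : ℚ) • powExp i b ∈ seqSpan.map (recOp m) :=
      Submodule.sum_mem _ fun i hi => Submodule.smul_mem _ _ (ih i (mem_range.1 hi))
    by_cases hbm : (b : ℚ) = m
    · have image := Submodule.mem_map_of_mem (f := recOp m) (powExp_mem_seqSpan (a + 1) hb)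
      rw [recOp_powExp, hbm, sub_self, zero_smul, zero_add, ← hbm,
        Submodule.smul_mem_iff _ hb0, sum_range_succ] at image
      have lower' : ∑ i ∈ range a, ((a + 1).choose i : ℚ) • powExp i b ∈
          seqSpan.map (recOp (b : ℚ)) :=
        Submodule.sum_mem _ fun i hi =>
          Submodule.smul_mem _ _ (by rw [hbm]; exact ih i (mem_range.1 hi))
      rw [Submodule.add_mem_iff_right _ lower', Submodule.smul_mem_iff _ (by
        rw [Nat.choose_succ_self_right]; positivity)] at image
      rwa [← hbm]
    · have image := Submodule.mem_map_of_mem (f := recOp m) (powExp_mem_seqSpan a hb)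
      rwa [recOp_powExp, Submodule.add_mem_iff_left _ (Submodule.smul_mem _ _ lower),
        Submodule.smul_mem_iff _ (sub_ne_zero.2 hbm)] at image

lemma recOp_single_zero (m : ℚ) :
    recOp m (Pi.single 0 1) = (-m) • (Pi.single 0 1 : ℕ → ℚ) := by
  ext n
  simp [recOp_apply]

lemma recOp_single_succ (m : ℚ) (c : ℕ) :
    recOp m (Pi.single (c + 1) 1) =
      (Pi.single c 1 : ℕ → ℚ) + (-m) • (Pi.single (c + 1) 1 : ℕ → ℚ) := by
  ext n
  simp [recOp_apply, Pi.single_apply, sub_eq_add_neg]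

lemma single_mem_map_recOp (m : ℚ) (c : ℕ) :
    (Pi.single c 1 : ℕ → ℚ) ∈ seqSpan.map (recOp m) := by
  by_cases hm : m = 0
  · have image := Submodule.mem_map_of_mem (f := recOp m) (single_mem_seqSpan (c + 1))
    rwa [recOp_single_succ, hm, neg_zero, zero_smul, add_zero, ← hm] at image
  · induction c with
    | zero =>
      have image := Submodule.mem_map_of_mem (f := recOp m) (single_mem_seqSpan 0)
      rwa [recOp_single_zero, Submodule.smul_mem_iff _ (neg_ne_zero.2 hm)] at image
    | succ c ih =>
      have image := Submodule.mem_map_of_mem (f := recOp m) (single_mem_seqSpan (c + 1))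
      rwa [recOp_single_succ, Submodule.add_mem_iff_right _ ih,
        Submodule.smul_mem_iff _ (neg_ne_zero.2 hm)] at image

lemma seqSpan_le_map_recOp (m : ℕ) : seqSpan ≤ seqSpan.map (recOp m) := by
  refine Submodule.span_le.2 ?_
  rintro f (⟨a, b, hb, rfl⟩ | ⟨c, rfl⟩)
  · exact powExp_mem_map_recOp m a hb
  · exact single_mem_map_recOp m c

/-- Every inhomogeneity in `seqSpan` has a solution in `seqSpan` vanishing at `0`. -/
lemma exists_seqSpan_solution (m : ℕ) {u : ℕ → ℚ} (hu : u ∈ seqSpan) :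
    ∃ g ∈ seqSpan, g 0 = 0 ∧ ∀ n, g (n + 1) = m * g n + u n := by
  obtain ⟨g, hg, rfl⟩ := seqSpan_le_map_recOp m hu
  refine ⟨g - g 0 • fun n => (m : ℚ) ^ n,
    Submodule.sub_mem _ hg (Submodule.smul_mem _ _ (geom_mem_seqSpan m)), by simp, fun n => ?_⟩
  simp only [Pi.sub_apply, Pi.smul_apply, smul_eq_mul, recOp_apply]
  ring

/-- A sequence with finite support lies in `seqSpan`. -/
lemma mem_seqSpan_of_finite_support {f : ℕ → ℚ} (hf : f.support.Finite) : f ∈ seqSpan := by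
  have hsum : f = ∑ c ∈ hf.toFinset, f c • (Pi.single c 1 : ℕ → ℚ) := by
    ext n
    simp only [Finset.sum_apply, Pi.smul_apply, smul_eq_mul, Pi.single_apply, mul_ite, mul_one,
      mul_zero, Finset.sum_ite_eq, Set.Finite.mem_toFinset, Function.mem_support]
    split_ifs with h
    · rfl
    · simpa using h
  rw [hsum]
  exact Submodule.sum_mem _ fun c _ => Submodule.smul_mem _ _ (single_mem_seqSpan c)

lemma indicator_mem_seqSpan {S : Set ℕ} (hS : S = ∅ ∨ (∃ c : ℕ, S = {c}) ∨ Sᶜ.Finite)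
    {f : ℕ → ℚ} (hf : f ∈ seqSpan) : S.indicator f ∈ seqSpan := by
  have finite_case {T : Set ℕ} (hT : T.Finite) : T.indicator f ∈ seqSpan :=
    mem_seqSpan_of_finite_support (hT.subset Set.support_indicator_subset)
  rcases hS with rfl | ⟨c, rfl⟩ | hS
  · exact finite_case Set.finite_empty
  · exact finite_case (Set.finite_singleton c)
  · rw [← sub_eq_of_eq_add (Set.indicator_self_add_compl S f).symm]
    exact Submodule.sub_mem _ hf (finite_case hS)

variable {d : ℕ}

lemma isPolyExp_zero : IsPolyExp (0 : (Fin d → ℤ) → ℕ → ℚ) :=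
  ⟨0, Fin.elim0, Fin.elim0, Fin.elim0, Fin.elim0, Fin.elim0, fun j => j.elim0, fun j => j.elim0,
    by simp⟩

lemma isPolyExp_add {p q : (Fin d → ℤ) → ℕ → ℚ} (hp : IsPolyExp p) (hq : IsPolyExp q) :
    IsPolyExp (p + q) := by
  obtain ⟨ℓ, S, v, w, a, b, hS, hb, hp⟩ := hp
  obtain ⟨ℓ', S', v', w', a', b', hS', hb', hq⟩ := hq
  refine ⟨ℓ + ℓ', Fin.append S S', Fin.append v v', Fin.append w w', Fin.append a a',
    Fin.append b b', fun j => ?_, fun j => ?_, fun x n => ?_⟩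
  · refine Fin.addCases (fun i => ?_) (fun i => ?_) j
    · simpa only [Fin.append_left] using hS i
    · simpa only [Fin.append_right] using hS' i
  · refine Fin.addCases (fun i => ?_) (fun i => ?_) j
    · simpa only [Fin.append_left] using hb i
    · simpa only [Fin.append_right] using hb' i
  · simp only [Pi.add_apply, hp, hq, Fin.sum_univ_add, Fin.append_left, Fin.append_right]

lemma isPolyExp_sum {ι : Type*} (s : Finset ι) (f : ι → (Fin d → ℤ) → ℕ → ℚ)
    (hf : ∀ i ∈ s, IsPolyExp (f i)) : IsPolyExp (∑ i ∈ s, f i) :=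
  Finset.sum_induction f IsPolyExp (fun _ _ => isPolyExp_add) isPolyExp_zero hf

lemma isPolyExp_affine_mul {u : ℕ → ℚ} (hu : u ∈ seqSpan) (v : Fin d → ℚ) (w : ℚ) :
    IsPolyExp fun (x : Fin d → ℤ) n => ((∑ i, v i * (x i : ℚ)) + w) * u n := by
  induction hu using Submodule.span_induction generalizing v w with
  | mem u hu =>
    rcases hu with ⟨a, b, hb, rfl⟩ | ⟨c, rfl⟩
    · exact ⟨1, fun _ => Set.univ, fun _ => v, fun _ => w, fun _ => a, fun _ => b,
        fun _ => Or.inr (Or.inr (by simp)), fun _ => hb, fun x n => by simp [powExp, mul_assoc]⟩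
    · exact ⟨1, fun _ => {c}, fun _ => v, fun _ => w, fun _ => 0, fun _ => 1,
        fun _ => Or.inr (Or.inl ⟨c, rfl⟩), fun _ => le_rfl, fun x n => by
          simp [Set.indicator_apply, Pi.single_apply]⟩
  | zero => simpa using! isPolyExp_zero
  | add u u' _ _ hu hu' =>
    convert isPolyExp_add (hu v w) (hu' v w) using 1
    ext x n
    simp only [Pi.add_apply, mul_add]
  | smul r u _ hu =>
    convert hu (fun i => r * v i) (r * w) using 1
    ext x n
    simp only [Pi.smul_apply, smul_eq_mul, mul_assoc, ← mul_sum]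
    ring

end PolyExp

open PolyExp in
/-- closed form for a single variable: there is a poly-exponential
expression `q` with `q(x,0) = x_k` and `q(x,n) = m·q(x,n−1) + p(x,n−1)` for `n > 0`. -/
theorem closed_form_single_variable (d : ℕ) (hd : 1 ≤ d) (m : ℕ)
    (p : (Fin d → ℤ) → ℕ → ℚ) (hp : IsPolyExp p) (k : Fin d) :
    ∃ q : (Fin d → ℤ) → ℕ → ℚ, IsPolyExp q ∧
      (∀ x : Fin d → ℤ, q x 0 = (x k : ℚ)) ∧
      (∀ (x : Fin d → ℤ) (n : ℕ), 0 < n →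
        q x n = (m : ℚ) * q x (n - 1) + p x (n - 1)) := by
  obtain ⟨ℓ, S, v, w, a, b, hS, hb, hp⟩ := hp
  choose g hg hg0 hrec using fun j => exists_seqSpan_solution m
    (indicator_mem_seqSpan (hS j) (powExp_mem_seqSpan (a j) (hb j)))
  refine ⟨(fun x n => ((∑ i, (Pi.single k 1 : Fin d → ℚ) i * (x i : ℚ)) + 0) * (m : ℚ) ^ n) +
      ∑ j, fun x n => ((∑ i, v j i * (x i : ℚ)) + w j) * g j n,
    isPolyExp_add (isPolyExp_affine_mul (geom_mem_seqSpan m) _ _)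
      (isPolyExp_sum _ _ fun j _ => isPolyExp_affine_mul (hg j) _ _), fun x => ?_, ?_⟩
  · simp [Finset.sum_apply, hg0, Pi.single_apply]
  · rintro x (_ | n) hn
    · exact absurd hn (lt_irrefl 0)
    · simp only [Pi.add_apply, Finset.sum_apply, Nat.add_sub_cancel, hp, hrec]
      rw [mul_add, Finset.mul_sum, add_assoc, ← Finset.sum_add_distrib]
      congr 1
      · ring
      · refine Finset.sum_congr rfl fun j _ => ?_
        by_cases hn : n ∈ S j <;> simp [hn, powExp] <;> ring
end

section
/- Let p be a normalized poly-exponential sequence, p(n) = ∑_{j=1}^ℓ c_j·n^{a_j}·b_jⁿ with ℓ ≥ 1, c_j ∈ ℚ \ {0}, a_j ∈ ℕ, b_j ∈ ℕ with b_j ≥ 1, and pairwise distinct pairs (b_j, a_j). Let j* be the index at which (b_j, a_j) is lexicographically maximal. Then, as real sequences in n → ∞, p is big-O of n^{a_{j*}}·b_{j*}ⁿ and n^{a_{j*}}·b_{j*}ⁿ is big-O of p; i.e., O(p) = O(c_{j*}·n^{a_{j*}}·b_{j*}ⁿ). -/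
open Filter Asymptotics

/-- The addends `n^a·bⁿ` are ordered asymptotically by the lexicographic order on `(b, a)`. -/
theorem isLittleO_pow_mul_pow_of_lex_lt {a₁ a₂ b₁ b₂ : ℕ}
    (h : b₁ < b₂ ∨ (b₁ = b₂ ∧ a₁ < a₂)) :
    (fun n : ℕ => (n : ℝ) ^ a₁ * (b₁ : ℝ) ^ n) =o[atTop]
      (fun n : ℕ => (n : ℝ) ^ a₂ * (b₂ : ℝ) ^ n) := by
  rcases h with h | ⟨rfl, h⟩
  · have hexp : (fun n : ℕ => (n : ℝ) ^ a₁ * (b₁ : ℝ) ^ n) =o[atTop]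
        (fun n : ℕ => (b₂ : ℝ) ^ n) :=
      isLittleO_pow_const_mul_const_pow_const_pow_of_norm_lt a₁ (by simpa using h)
    refine hexp.trans_isBigO (IsBigO.of_bound 1 ?_)
    filter_upwards [eventually_ge_atTop 1] with n hn
    have hpow : (1 : ℝ) ≤ (n : ℝ) ^ a₂ := one_le_pow₀ (by exact_mod_cast hn)
    rw [one_mul, norm_mul, Real.norm_of_nonneg (zero_le_one.trans hpow)]
    exact le_mul_of_one_le_left (norm_nonneg _) hpow
  · exact ((isLittleO_pow_pow_atTop_of_lt h).comp_tendsto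
      tendsto_natCast_atTop_atTop).mul_isBigO (isBigO_refl _ _)

/-- for a normalized poly-exponential sequence
`p(n) = ∑_j c_j·n^{a_j}·b_jⁿ` (all `c_j ≠ 0`, `b_j ≥ 1`, pairwise distinct pairs
`(b_j,a_j)`), the `lex`-maximal addend `c_{j*}·n^{a_{j*}}·b_{j*}ⁿ` determines the
asymptotic growth: `O(p) = O(c_{j*}·n^{a_{j*}}·b_{j*}ⁿ)`. -/
theorem npe_growth_determined_by_max_addend (ℓ : ℕ) (hℓ : 1 ≤ ℓ)
    (c : Fin ℓ → ℚ) (hc : ∀ j, c j ≠ 0)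
    (a : Fin ℓ → ℕ) (b : Fin ℓ → ℕ) (hb : ∀ j, 1 ≤ b j)
    (hdist : ∀ i j : Fin ℓ, i ≠ j → (b i, a i) ≠ (b j, a j))
    (p : ℕ → ℚ)
    (hp : ∀ n : ℕ, p n = ∑ j, c j * (n : ℚ) ^ a j * (b j : ℚ) ^ n)
    (jmax : Fin ℓ)
    (hmax : ∀ j : Fin ℓ, j ≠ jmax →
      b j < b jmax ∨ (b j = b jmax ∧ a j < a jmax)) :
    ((fun n : ℕ => ((p n : ℝ))) =O[atTop]
      (fun n : ℕ => (c jmax : ℝ) * (n : ℝ) ^ a jmax * (b jmax : ℝ) ^ n)) ∧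
    ((fun n : ℕ => (c jmax : ℝ) * (n : ℝ) ^ a jmax * (b jmax : ℝ) ^ n) =O[atTop]
      (fun n : ℕ => ((p n : ℝ)))) := by
  have hequiv : (fun n : ℕ => (p n : ℝ)) ~[atTop]
      (fun n : ℕ => (c jmax : ℝ) * (n : ℝ) ^ a jmax * (b jmax : ℝ) ^ n) := by
    have hsum : (fun n : ℕ => ∑ j ∈ Finset.univ.erase jmax,
        (c j : ℝ) * ((n : ℝ) ^ a j * (b j : ℝ) ^ n)) =o[atTop]
        (fun n : ℕ => (c jmax : ℝ) * ((n : ℝ) ^ a jmax * (b jmax : ℝ) ^ n)) :=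
      IsLittleO.fun_sum fun j hj =>
        ((isLittleO_pow_mul_pow_of_lex_lt (hmax j (Finset.ne_of_mem_erase hj))).const_mul_left
          _).const_mul_right (Rat.cast_ne_zero.mpr (hc jmax))
    simp only [← mul_assoc] at hsum
    refine hsum.congr_left fun n => ?_
    rw [Pi.sub_apply, hp, Rat.cast_sum, ← Finset.add_sum_erase _ _ (Finset.mem_univ jmax)]
    push_cast
    ring
  exact ⟨hequiv.isBigO, hequiv.symm.isBigO⟩
end

section
/- Fix d ≥ 1 and k ≥ 1. For each i ∈ {1,…,k} let p_i : ℤ^d → ℕ → ℚ be given by p_i(x, n) = ∑_{j=1}^{ℓ_i} α_{i,j}(x)·n^{a_{i,j}}·b_{i,j}ⁿ, where α_{i,j} : ℤ^d → ℚ are affine functions, a_{i,j} ∈ ℕ, b_{i,j} ∈ ℕ with b_{i,j} ≥ 1, and for each i the pairs (b_{i,j}, a_{i,j}) are pairwise distinct and strictly decreasing in j with respect to the lexicographic order (i.e., (b_{i,j}, a_{i,j}) ><_lex (b_{i,j+1}, a_{i,j+1}) for all j). Then for every c ∈ ℤ^d the following are equivalent: (1) there exists n₀ ∈ ℕ such that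 p_i(c, n) > 0 for all n > n₀ and all i ∈ {1,…,k}; (2) for every i ∈ {1,…,k} there exists j ∈ {1,…,ℓ_i} with α_{i,j}(c) > 0 and α_{i,j'}(c) = 0 for all j' < j. In particular, the existence of c ∈ ℤ^d and n₀ ∈ ℕ with p_i(c,n) > 0 for all n > n₀ and all i is equivalent to the satisfiability over ℤ^d of the linear-arithmetic formula ⋀_{i=1}^k ⋁_{j=1}^{ℓ_i} (α_{i,j}(x) > 0 ∧ ⋀_{j' < j} α_{i,j'}(x) = 0). -/
open Filter Asymptotics

/-- `n ^ a' * b' ^ n` is negligible against `n ^ a * b ^ n` when `(b', a')` is lexicographically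
smaller than `(b, a)`. -/
theorem isLittleO_pow_mul_pow_of_lex {a a' b b' : ℕ} (h : b' < b ∨ b' = b ∧ a' < a) :
    (fun n : ℕ => (n : ℝ) ^ a' * (b' : ℝ) ^ n) =o[atTop]
      fun n : ℕ => (n : ℝ) ^ a * (b : ℝ) ^ n := by
  rcases h with h | ⟨rfl, h⟩
  · have hlittle := isLittleO_pow_const_mul_const_pow_const_pow_of_norm_lt (R := ℝ) a'
      (r₁ := (b' : ℝ)) (r₂ := (b : ℝ)) (by simpa using h)
    refine hlittle.trans_isBigO (IsBigO.of_bound 1 ?_)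
    filter_upwards [eventually_ge_atTop 1] with n hn
    have hn' : (1 : ℝ) ≤ (n : ℝ) ^ a := one_le_pow₀ (by exact_mod_cast hn)
    rw [one_mul, norm_mul, Real.norm_of_nonneg (zero_le_one.trans hn')]
    exact le_mul_of_one_le_left (norm_nonneg _) hn'
  · exact ((isLittleO_pow_pow_atTop_of_lt (𝕜 := ℝ) h).comp_tendsto
      tendsto_natCast_atTop_atTop).mul_isBigO (isBigO_refl _ _)

section LeadingCoefficient

variable {ι : Type*} [Fintype ι] [LinearOrder ι] {a b : ι → ℕ} {u : ι → ℚ}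

/-- A poly-exponential sum with lexicographically decreasing exponents is eventually positive when
its first nonzero coefficient is positive. -/
theorem eventually_sum_pos_of_leading_pos (hb : ∀ j, 1 ≤ b j)
    (hlt : ∀ j j', j < j' → b j' < b j ∨ b j' = b j ∧ a j' < a j)
    {j : ι} (hj : 0 < u j) (hz : ∀ j' < j, u j' = 0) :
    ∀ᶠ n : ℕ in atTop, 0 < ∑ i, u i * (n : ℚ) ^ a i * (b i : ℚ) ^ n := by
  have htail : (fun n : ℕ => ∑ i ∈ Finset.univ.erase j, (u i : ℝ) * ((n : ℝ) ^ a i * (b i : ℝ) ^ n))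
      =o[atTop] fun n : ℕ => (n : ℝ) ^ a j * (b j : ℝ) ^ n := by
    refine IsLittleO.fun_sum fun i hi => ?_
    rcases lt_or_gt_of_ne (Finset.ne_of_mem_erase hi) with h | h
    · simp [hz i h]
    · exact (isLittleO_pow_mul_pow_of_lex (hlt j i h)).const_mul_left _
  have hj' : (0 : ℝ) < u j := by exact_mod_cast hj
  filter_upwards [htail.bound (half_pos hj'), eventually_ge_atTop 1] with n hn hn1
  have hlead : (0 : ℝ) < (n : ℝ) ^ a j * (b j : ℝ) ^ n := by
    have hbj : (0 : ℝ) < b j := by exact_mod_cast hb j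
    have hn0 : (0 : ℝ) < n := by exact_mod_cast hn1
    positivity
  rw [Real.norm_of_nonneg hlead.le, Real.norm_eq_abs] at hn
  have hreal : (0 : ℝ) < ∑ i, (u i : ℝ) * ((n : ℝ) ^ a i * (b i : ℝ) ^ n) := by
    rw [← Finset.add_sum_erase _ _ (Finset.mem_univ j)]
    linarith [neg_le_of_abs_le hn, mul_pos hj' hlead]
  simp only [← mul_assoc] at hreal
  exact_mod_cast hreal

/-- A poly-exponential sum with lexicographically decreasing exponents is eventually positive iff
its first nonzero coefficient exists and is positive. -/
theorem eventually_sum_pos_iff_leading_pos (hb : ∀ j, 1 ≤ b j)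
    (hlt : ∀ j j', j < j' → b j' < b j ∨ b j' = b j ∧ a j' < a j) :
    (∀ᶠ n : ℕ in atTop, 0 < ∑ i, u i * (n : ℚ) ^ a i * (b i : ℚ) ^ n) ↔
      ∃ j, 0 < u j ∧ ∀ j' < j, u j' = 0 := by
  refine ⟨fun hpos => ?_, fun ⟨j, hj, hz⟩ => eventually_sum_pos_of_leading_pos hb hlt hj hz⟩
  by_cases hu : ∃ j, u j ≠ 0
  · obtain ⟨j, hj, hmin⟩ := WellFounded.has_min (wellFounded_lt (α := ι)) {j | u j ≠ 0} hu
    have hz : ∀ j' < j, u j' = 0 := fun j' h => by_contra fun h' => hmin j' h' h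
    refine ⟨j, lt_of_not_ge fun hle => ?_, hz⟩
    have hneg := eventually_sum_pos_of_leading_pos (u := fun i => -u i) hb hlt
      (neg_pos.2 (lt_of_le_of_ne hle hj)) fun j' h => by simp [hz j' h]
    obtain ⟨n, h₁, h₂⟩ := (hpos.and hneg).exists
    simp only [neg_mul, Finset.sum_neg_distrib] at h₂
    linarith
  · push Not at hu
    obtain ⟨n, hn⟩ := hpos.exists
    simp [hu] at hn

end LeadingCoefficient

/-- deciding eventual positiveness of normalized poly-exponential
expressions: if each `p_i(x,n) = ∑_j α_{i,j}(x)·n^{a_{i,j}}·b_{i,j}ⁿ` with affine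
`α_{i,j}` and the pairs `(b_{i,j}, a_{i,j})` strictly lex-decreasing in `j`, then
for every `c` eventual positivity of all `p_i(c,·)` is equivalent to the
linear-arithmetic condition (2), and hence the existence of such a `c` is
equivalent to satisfiability over `ℤ^d` of the corresponding formula. -/
theorem eventual_positivity_decidable_characterization
    (d k : ℕ) (hd : 1 ≤ d) (hk : 1 ≤ k)
    (ℓ : Fin k → ℕ)
    (α : (i : Fin k) → Fin (ℓ i) → (Fin d → ℤ) → ℚ)
    (hα : ∀ (i : Fin k) (j : Fin (ℓ i)), ∃ (v : Fin d → ℚ) (w : ℚ),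
      ∀ x : Fin d → ℤ, α i j x = (∑ t, v t * (x t : ℚ)) + w)
    (a : (i : Fin k) → Fin (ℓ i) → ℕ) (b : (i : Fin k) → Fin (ℓ i) → ℕ)
    (hb : ∀ (i : Fin k) (j : Fin (ℓ i)), 1 ≤ b i j)
    (hlt : ∀ (i : Fin k) (j j' : Fin (ℓ i)), j < j' →
      (b i j' < b i j ∨ (b i j' = b i j ∧ a i j' < a i j)))
    (p : (i : Fin k) → (Fin d → ℤ) → ℕ → ℚ)
    (hp : ∀ (i : Fin k) (x : Fin d → ℤ) (n : ℕ),
      p i x n = ∑ j, α i j x * (n : ℚ) ^ a i j * (b i j : ℚ) ^ n) :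
    (∀ c : Fin d → ℤ,
      ((∃ n₀ : ℕ, ∀ n : ℕ, n₀ < n → ∀ i : Fin k, 0 < p i c n) ↔
       (∀ i : Fin k, ∃ j : Fin (ℓ i),
         0 < α i j c ∧ ∀ j' : Fin (ℓ i), j' < j → α i j' c = 0))) ∧
    ((∃ (c : Fin d → ℤ) (n₀ : ℕ), ∀ n : ℕ, n₀ < n → ∀ i : Fin k, 0 < p i c n) ↔
     (∃ c : Fin d → ℤ, ∀ i : Fin k, ∃ j : Fin (ℓ i),
       0 < α i j c ∧ ∀ j' : Fin (ℓ i), j' < j → α i j' c = 0)) := by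
  have hpointwise : ∀ c : Fin d → ℤ,
      ((∃ n₀ : ℕ, ∀ n : ℕ, n₀ < n → ∀ i : Fin k, 0 < p i c n) ↔
       (∀ i : Fin k, ∃ j : Fin (ℓ i),
         0 < α i j c ∧ ∀ j' : Fin (ℓ i), j' < j → α i j' c = 0)) := fun c => by
    simp only [← fun i => eventually_sum_pos_iff_leading_pos (u := fun j => α i j c) (hb i) (hlt i),
      ← hp, ← eventually_all]
    exact (atTop_basis_Ioi.eventually_iff.trans (by simp)).symm
  exact ⟨hpointwise, exists_congr hpointwise⟩
end
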